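/- Let p be an odd prime and let i be an integer with 0 ≤ i < p. Then St^{(i,ip)}(Q_{2,0}) = (−1)^i·Q_{2,0}^{i+1}·Q_{2,1}^{ip}. -/

import Mathlib

open MvPolynomial Finset

/-- The total Steenrod-Milnor operation `φ : R → R[t₁,t₂]`,
sending `y_k ↦ y_k + y_k^p t₁ + y_k^{p²} t₂`. Here `R = F_p[y₁,y₂]`
and `R[t₁,t₂]` is modelled as `MvPolynomial (Fin 2) R`. -/
noncomputable def phi (p : ℕ) :
    MvPolynomial (Fin 2) (ZMod p) →ₐ[ZMod p]
      MvPolynomial (Fin 2) (MvPolynomial (Fin 2) (ZMod p)) :=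
  aeval (fun k => C (X k) + C (X k ^ p) * X 0 + C (X k ^ (p ^ 2)) * X 1)

/-- The Steenrod-Milnor operation `St^{(i,j)}` : the coefficient of
`t₁^i t₂^j` in `φ f`. -/
noncomputable def St (p i j : ℕ) (f : MvPolynomial (Fin 2) (ZMod p)) :
    MvPolynomial (Fin 2) (ZMod p) :=
  coeff (Finsupp.single (0 : Fin 2) i + Finsupp.single (1 : Fin 2) j) (phi p f)

/-- `L₂ = y₁ y₂^p - y₁^p y₂`. -/
noncomputable def L2 (p : ℕ) : MvPolynomial (Fin 2) (ZMod p) :=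
  X 0 * X 1 ^ p - X 0 ^ p * X 1

/-- `L_{2,0} = y₁^p y₂^{p²} - y₁^{p²} y₂^p`. -/
noncomputable def L20 (p : ℕ) : MvPolynomial (Fin 2) (ZMod p) :=
  X 0 ^ p * X 1 ^ (p ^ 2) - X 0 ^ (p ^ 2) * X 1 ^ p

/-- `L_{2,1} = y₁ y₂^{p²} - y₁^{p²} y₂`. -/
noncomputable def L21 (p : ℕ) : MvPolynomial (Fin 2) (ZMod p) :=
  X 0 * X 1 ^ (p ^ 2) - X 0 ^ (p ^ 2) * X 1

/-- The binomial coefficients `(p-1 choose i)` are `(-1)^i` in characteristic `p`. -/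
theorem choose_pred_char {S : Type*} [CommRing S] (p : ℕ) (hp : p.Prime) [CharP S p] (i : ℕ)
    (hi : i < p) : ((Nat.choose (p - 1) i : ℕ) : S) = (-1) ^ i := by
  induction i with
  | zero => simp
  | succ k ih =>
    have h1 := ih (by omega)
    have h2 : (p - 1).choose k + (p - 1).choose (k + 1) = p.choose (k + 1) := by
      have := hp.pos
      conv_rhs => rw [show p = (p - 1) + 1 by omega]
      rw [Nat.choose_succ_succ]
    have h3 : ((p.choose (k + 1) : ℕ) : S) = 0 :=
      (CharP.cast_eq_zero_iff S p _).2 (hp.dvd_choose_self (by omega) hi)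
    rw [← h2, Nat.cast_add, h1] at h3
    rw [pow_succ]
    linear_combination h3

theorem L2_ne_zero (p : ℕ) (hp : p.Prime) : L2 p ≠ 0 := by
  have : Fact p.Prime := ⟨hp⟩
  intro h
  have h1 := congrArg (aeval (R := ZMod p) ![(1 : Polynomial (ZMod p)), Polynomial.X]) h
  simp only [L2, map_sub, map_mul, map_pow, aeval_X, map_zero] at h1
  simp at h1
  exact FiniteField.X_pow_card_sub_X_ne_zero (ZMod p) hp.one_lt h1

/-- The substitution `s ↦ t₁ t₂^p`, `t₂ ↦ t₂`. -/
noncomputable def psi (p : ℕ) (R : Type*) [CommRing R] :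
    MvPolynomial (Fin 2) R →ₐ[R] MvPolynomial (Fin 2) R :=
  aeval ![X 0 * X 1 ^ p, X 1]

theorem coeff_X1_mul_psi {R : Type*} [CommRing R] (p i : ℕ) (g : MvPolynomial (Fin 2) R) :
    coeff (Finsupp.single (0 : Fin 2) i + Finsupp.single (1 : Fin 2) (i * p))
      (X 1 * psi p R g) = 0 := by
  induction g using MvPolynomial.induction_on' with
  | add f g hf hg => rw [map_add, mul_add, coeff_add, hf, hg, add_zero]
  | monomial u a =>
    have : (X 1 * psi p R (monomial u a) : MvPolynomial (Fin 2) R) =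
        monomial (Finsupp.single (0 : Fin 2) (u 0) +
          Finsupp.single (1 : Fin 2) (u 0 * p + u 1 + 1)) a := by
      rw [psi, aeval_monomial, Finsupp.prod_fintype _ _ (by simp), Fin.prod_univ_two,
        monomial_eq, Finsupp.prod_fintype _ _ (by simp), Fin.prod_univ_two]
      simp [algebraMap_eq]
      ring
    rw [this, coeff_monomial, if_neg]
    intro h
    have h0 := DFunLike.congr_fun h 0
    have h1 := DFunLike.congr_fun h 1
    simp at h0 h1
    subst h0
    omega

theorem coeff_binom {R : Type*} [CommRing R] (p n i : ℕ) (c b : R) (hi : i ≤ n) :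
    coeff (Finsupp.single (0 : Fin 2) i + Finsupp.single (1 : Fin 2) (i * p))
      ((C b * (X 0 * X 1 ^ p) + C c) ^ n : MvPolynomial (Fin 2) R) =
      b ^ i * c ^ (n - i) * (n.choose i : R) := by
  rw [add_pow, coeff_sum]
  have key : ∀ j ∈ range (n + 1),
      coeff (Finsupp.single (0 : Fin 2) i + Finsupp.single (1 : Fin 2) (i * p))
      ((C b * (X 0 * X 1 ^ p)) ^ j * C c ^ (n - j) * (n.choose j : MvPolynomial (Fin 2) R)) =
      if j = i then b ^ i * c ^ (n - i) * (n.choose i : R) else 0 := by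
    intro j _
    have : ((C b * (X 0 * X 1 ^ p)) ^ j * C c ^ (n - j) * (n.choose j : MvPolynomial (Fin 2) R))
        = monomial (Finsupp.single (0 : Fin 2) j + Finsupp.single (1 : Fin 2) (j * p))
          (b ^ j * c ^ (n - j) * (n.choose j : R)) := by
      rw [monomial_eq, Finsupp.prod_fintype _ _ (by simp), Fin.prod_univ_two]
      simp
      ring
    rw [this, coeff_monomial]
    by_cases h : j = i
    · subst h; simp
    · rw [if_neg, if_neg h]
      intro h'
      have h0 := DFunLike.congr_fun h' 0
      simp at h0
      exact h h0
  rw [sum_congr rfl key, sum_ite_eq', if_pos (by simp; omega)]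

theorem coeff_X0_pow_mul {R : Type*} [CommRing R] (p i j : ℕ) (hi : i < p)
    (g : MvPolynomial (Fin 2) R) :
    coeff (Finsupp.single (0 : Fin 2) i + Finsupp.single (1 : Fin 2) j) (X 0 ^ p * g) = 0 := by
  rw [X_pow_eq_monomial, coeff_monomial_mul', if_neg]
  intro h
  have := h 0
  simp at this
  omega

/-- Coefficient extraction from a power. -/
theorem coeff_main {R : Type*} [CommRing R] (p n i : ℕ) (hip : i < p) (hi : i ≤ n) (c b : R)
    (G H : MvPolynomial (Fin 2) R) :
    coeff (Finsupp.single (0 : Fin 2) i + Finsupp.single (1 : Fin 2) (i * p))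
      ((psi p R (C b * X 0 + C c + X 1 * H) + X 0 ^ p * G) ^ n) =
      b ^ i * c ^ (n - i) * (n.choose i : R) := by
  obtain ⟨K, hK⟩ : X 0 ^ p ∣ (psi p R (C b * X 0 + C c + X 1 * H) + X 0 ^ p * G) ^ n -
      (psi p R (C b * X 0 + C c + X 1 * H)) ^ n :=
    dvd_trans ⟨G, by ring⟩ (sub_dvd_pow_sub_pow _ _ n)
  obtain ⟨M, hM⟩ : (X 1 : MvPolynomial (Fin 2) R) ∣ (C b * X 0 + C c + X 1 * H) ^ n -
      (C b * X 0 + C c) ^ n :=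
    dvd_trans ⟨H, by ring⟩ (sub_dvd_pow_sub_pow _ _ n)
  rw [sub_eq_iff_eq_add] at hK hM
  rw [hK, coeff_add, coeff_X0_pow_mul p i _ hip, zero_add, ← map_pow, hM, map_add, map_mul,
    coeff_add]
  have h1 : psi p R (X 1) = X 1 := by simp [psi]
  have h2 : psi p R ((C b * X 0 + C c) ^ n) = (C b * (X 0 * X 1 ^ p) + C c) ^ n := by
    simp [psi, algebraMap_eq]
  rw [h1, coeff_X1_mul_psi, zero_add, h2, coeff_binom p n i c b hi]

theorem phi_L2 (p : ℕ) (hp : p.Prime) : ∃ G H, phi p (L2 p) =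
    psi p _ (C (L21 p ^ p) * X 0 + C (L2 p) + X 1 * H) + X 0 ^ p * G := by
  have : Fact p.Prime := ⟨hp⟩
  refine ⟨C (L21 p) + C (L2 p ^ p) * X 0,
    C (X 0 * X 1 ^ p ^ 3 - X 0 ^ p ^ 3 * X 1) * X 1 ^ (p - 1) - C (L2 p ^ p) +
      C (L2 p ^ p ^ 2) * X 1 ^ p, ?_⟩
  have hpp : (X 1 : MvPolynomial (Fin 2) (MvPolynomial (Fin 2) (ZMod p))) ^ p
      = X 1 * X 1 ^ (p - 1) := by
    rw [← pow_succ', Nat.sub_add_cancel hp.one_le]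
  have e1 : L21 p ^ p = X 0 ^ p * X 1 ^ p ^ 3 - X 0 ^ p ^ 3 * X 1 ^ p := by
    rw [L21, sub_pow_char, mul_pow, mul_pow, ← pow_mul, ← pow_mul, ← pow_succ]
  have e2 : L2 p ^ p = X 0 ^ p * X 1 ^ p ^ 2 - X 0 ^ p ^ 2 * X 1 ^ p := by
    rw [L2, sub_pow_char, mul_pow, mul_pow, ← pow_mul, ← pow_mul, ← sq]
  have e3 : L2 p ^ p ^ 2 = X 0 ^ p ^ 2 * X 1 ^ p ^ 3 - X 0 ^ p ^ 3 * X 1 ^ p ^ 2 := by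
    rw [sq, pow_mul, e2, sub_pow_char, mul_pow, mul_pow]
    simp only [← pow_mul, ← pow_succ, ← sq]
  have eY : ∀ k : Fin 2, (C (X k) + C (X k ^ p) * X 0 + C (X k ^ (p ^ 2)) * X 1 :
      MvPolynomial (Fin 2) (MvPolynomial (Fin 2) (ZMod p))) ^ p =
      C (X k ^ p) + C (X k ^ p ^ 2) * X 0 ^ p + C (X k ^ p ^ 3) * X 1 ^ p := by
    intro k
    rw [add_pow_char, add_pow_char, mul_pow, mul_pow]
    simp only [← map_pow, ← pow_mul, ← pow_succ, ← sq]
  rw [e1, e2, e3]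
  simp only [L21]
  have : phi p (L2 p) = phi p (X 0) * phi p (X 1) ^ p - phi p (X 0) ^ p * phi p (X 1) := by
    simp [L2]
  rw [this]
  simp only [phi, aeval_X, eY]
  simp only [psi, L2, map_add, map_sub, map_mul, map_pow, aeval_X, aeval_C, algebraMap_eq,
    Matrix.cons_val_zero, Matrix.cons_val_one]
  rw [hpp]
  ring

theorem st_iip_Q20 (p : ℕ) (hp : p.Prime) (hodd : Odd p)
    (Q0 Q1 : MvPolynomial (Fin 2) (ZMod p))
    (hQ0 : Q0 * L2 p = L20 p) (hQ1 : Q1 * L2 p = L21 p)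
    (i : ℕ) (hip : i < p) :
    St p i (i * p) Q0 =
      (-1 : MvPolynomial (Fin 2) (ZMod p)) ^ i * Q0 ^ (i + 1) * Q1 ^ (i * p) := by
  have : Fact p.Prime := ⟨hp⟩
  have hQ : Q0 = L2 p ^ (p - 1) := by
    apply mul_right_cancel₀ (L2_ne_zero p hp)
    rw [hQ0, ← pow_succ, Nat.sub_add_cancel hp.one_le, L20, L2, sub_pow_char, mul_pow, mul_pow,
      ← pow_mul, ← pow_mul, ← sq]
  obtain ⟨G, H, h⟩ := phi_L2 p hp
  rw [St, hQ, map_pow, h, coeff_main p (p - 1) i hip (by omega), choose_pred_char p hp i hip,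
    ← hQ1]
  obtain ⟨m, hm⟩ : ∃ m, p = i + m + 1 := ⟨p - i - 1, by omega⟩
  have hexp : p * i + (p - 1 - i) = (p - 1) * (i + 1) := by
    rw [show p - 1 - i = m by omega, show p - 1 = i + m by omega, hm]; ring
  rw [mul_pow, mul_pow, ← pow_mul, ← pow_mul, ← pow_mul, ← hexp, pow_add, mul_comm i p]
  ring
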